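/- arXiv:2605.15640 — 4 statements merged into one kernel-verified Lean document; each statement's English description precedes it below -/
import Mathlib

section
/- Let p and p' be two conditional-probability arrays on Fin N with neighbor systems S and S' of the same size N_ω (each satisfying the stated positivity, normalization and uniform-marginal hypotheses). Then L_Ent(p) ≤ L_Ent(p') if and only if I(p) ≥ I(p'); in particular, minimizing the cross-entropy loss L_Ent is equivalent to maximizing the neighborhood mutual information I. -/
open Finset

/-- The cross-entropy loss `L_Ent(p)` with density-ratio estimator `m i k = N · p i k`. -/
noncomputable def LEnt (N : ℕ) (S : Fin N → Finset (Fin N)) (p : Fin N → Fin N → ℝ) : ℝ :=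
  -(1 / (N : ℝ)) * ∑ i, ∑ j ∈ S i,
      Real.log (((N : ℝ) * p i j) / ∑ k, (N : ℝ) * p i k)

/-- The neighborhood mutual information `I(p)`. -/
noncomputable def nMI (N Nω : ℕ) (S : Fin N → Finset (Fin N)) (p : Fin N → Fin N → ℝ) : ℝ :=
  (1 / (N : ℝ)) * ∑ i, (1 / (Nω : ℝ)) * ∑ j ∈ S i, Real.log (p i j / (1 / (N : ℝ)))

/-- The cross-entropy loss is a decreasing affine function of the neighborhood mutual
information. -/
theorem LEnt_eq_sub_nMI {N Nω : ℕ} (hN : 1 ≤ N) (hNω : 1 ≤ Nω)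
    {S : Fin N → Finset (Fin N)} (hS : ∀ i, (S i).card = Nω)
    {p : Fin N → Fin N → ℝ} (hsum : ∀ i, ∑ k, p i k = 1) (hpos : ∀ i, ∀ j ∈ S i, 0 < p i j) :
    LEnt N S p = Nω * Real.log N - Nω * nMI N Nω S p := by
  have hN0 : (N : ℝ) ≠ 0 := by positivity
  have hNω0 : (Nω : ℝ) ≠ 0 := by positivity
  have hlog (i : Fin N) : ∑ j ∈ S i, Real.log (p i j / (1 / (N : ℝ))) =
      ∑ j ∈ S i, Real.log (((N : ℝ) * p i j) / ∑ k, (N : ℝ) * p i k) + Nω * Real.log N := by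
    have hcard : (Nω : ℝ) * Real.log N = ∑ j ∈ S i, Real.log N := by
      rw [sum_const, hS i, nsmul_eq_mul]
    rw [hcard, ← sum_add_distrib]
    refine sum_congr rfl fun j hj => ?_
    rw [← mul_sum, hsum i, mul_one, mul_div_cancel_left₀ _ hN0, div_div_eq_mul_div, div_one,
      Real.log_mul (hpos i j hj).ne' hN0]
  simp only [LEnt, nMI, hlog, ← mul_sum, sum_add_distrib, sum_const, card_univ, Fintype.card_fin,
    nsmul_eq_mul]
  field_simp
  ring

/-- For any two conditional-probability arrays `p, p'` with neighbor
systems `S, S'` of the same size `N_ω`, `L_Ent(p) ≤ L_Ent(p')` iff `I(p) ≥ I(p')`: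
minimizing the cross-entropy loss is equivalent to maximizing the neighborhood
mutual information. -/
theorem LEnt_le_iff_nMI_ge
    (N Nω : ℕ) (hN : 1 ≤ N) (hNω : 1 ≤ Nω)
    (S S' : Fin N → Finset (Fin N))
    (hS : ∀ i, (S i).card = Nω) (hS' : ∀ i, (S' i).card = Nω)
    (p p' : Fin N → Fin N → ℝ)
    (hnonneg : ∀ i k, 0 ≤ p i k) (hnonneg' : ∀ i k, 0 ≤ p' i k)
    (hsum : ∀ i, ∑ k, p i k = 1) (hsum' : ∀ i, ∑ k, p' i k = 1)
    (hpos : ∀ i, ∀ j ∈ S i, 0 < p i j) (hpos' : ∀ i, ∀ j ∈ S' i, 0 < p' i j)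
    (hmarg : ∀ k : Fin N, (1 / (N : ℝ)) * ∑ i, p i k = 1 / (N : ℝ))
    (hmarg' : ∀ k : Fin N, (1 / (N : ℝ)) * ∑ i, p' i k = 1 / (N : ℝ)) :
    LEnt N S p ≤ LEnt N S' p' ↔ nMI N Nω S p ≥ nMI N Nω S' p' := by
  have hNω0 : (0 : ℝ) < Nω := by positivity
  rw [LEnt_eq_sub_nMI hN hNω hS hsum hpos, LEnt_eq_sub_nMI hN hNω hS' hsum' hpos',
    sub_le_sub_iff_left, mul_le_mul_iff_right₀ hNω0]
end

section
/- For every joint probability mass function p on 𝒳 × ℰ and every variational conditional distribution q, the mutual information is bounded below by the variational estimate: Σ_{x,e} p x e · log( p(x|e) / p_X(x) ) ≥ Σ_{x,e} p x e · log( q x e / p_X(x) ); that is, I(X;E) ≥ Σ_{x,e} p(x,e) log( q(x|e) / p(x) ) for any variational approximation q(x|e) of the true conditional p(x|e). -/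
open Finset

/-- **Gibbs' inequality** for positive functions on a finite set. -/
theorem sum_mul_log_le_sum_mul_log {ι : Type*} (s : Finset ι) (a b : ι → ℝ)
    (ha : ∀ i ∈ s, 0 < a i) (hb : ∀ i ∈ s, 0 < b i) (hab : ∑ i ∈ s, b i ≤ ∑ i ∈ s, a i) :
    ∑ i ∈ s, a i * Real.log (b i) ≤ ∑ i ∈ s, a i * Real.log (a i) := by
  have key : ∀ i ∈ s, a i * Real.log (b i) ≤ a i * Real.log (a i) + (b i - a i) := by
    intro i hi
    have hai := ha i hi
    have h := mul_le_mul_of_nonneg_left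
      (Real.log_le_sub_one_of_pos (div_pos (hb i hi) hai)) hai.le
    rw [Real.log_div (hb i hi).ne' hai.ne', mul_sub, mul_sub, mul_div_cancel₀ _ hai.ne'] at h
    linarith
  have h := sum_le_sum key
  rw [sum_add_distrib, sum_sub_distrib] at h
  linarith

/-- For every joint pmf `p` on `𝒳 × ℰ` and every variational
conditional distribution `q`, the mutual information is bounded below by the
variational estimate:
`I(X;E) ≥ Σ_{x,e} p(x,e) log( q(x|e) / p(x) )`. -/
theorem mutualInfo_ge_variational
    {𝒳 ℰ : Type*} [Fintype 𝒳] [Fintype ℰ]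
    (p : 𝒳 → ℰ → ℝ) (hp : ∀ x e, 0 < p x e)
    (hpsum : ∑ x, ∑ e, p x e = 1)
    (q : 𝒳 → ℰ → ℝ) (hq : ∀ x e, 0 < q x e)
    (hqsum : ∀ e, ∑ x, q x e = 1) :
    ∑ x, ∑ e, p x e * Real.log ((p x e / ∑ x', p x' e) / ∑ e', p x e')
      ≥ ∑ x, ∑ e, p x e * Real.log (q x e / ∑ e', p x e') := by
  have hX : ∀ x (_ : ℰ), 0 < ∑ e', p x e' := fun x e =>
    sum_pos (fun e' _ => hp x e') ⟨e, mem_univ e⟩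
  have hE : ∀ e (_ : 𝒳), 0 < ∑ x', p x' e := fun e x =>
    sum_pos (fun x' _ => hp x' e) ⟨x, mem_univ x⟩
  rw [ge_iff_le, sum_comm, sum_comm (f := fun x e =>
    p x e * Real.log ((p x e / ∑ x', p x' e) / ∑ e', p x e'))]
  refine sum_le_sum fun e _ => ?_
  have h := sum_mul_log_le_sum_mul_log univ (fun x => p x e)
    (fun x => q x e * ∑ x', p x' e) (fun x _ => hp x e)
    (fun x _ => mul_pos (hq x e) (hE e x)) (by rw [← sum_mul, hqsum, one_mul])
  rw [← sub_nonneg, ← sum_sub_distrib] at h ⊢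
  refine h.trans_eq (sum_congr rfl fun x _ => ?_)
  have hXx := (hX x e).ne'
  have hEe := (hE e x).ne'
  have hpx := (hp x e).ne'
  have hqx := (hq x e).ne'
  rw [Real.log_mul hqx hEe, Real.log_div (div_ne_zero hpx hEe) hXx,
    Real.log_div hpx hEe, Real.log_div hqx hXx]
  ring
end

section
/- For every joint probability mass function p on 𝒳 × ℰ and every variational conditional distribution q, the mutual information dominates the expected variational log-likelihood: Σ_{x,e} p x e · log( p(x|e) / p_X(x) ) ≥ Σ_{x,e} p x e · log( q x e ); that is, I(X;E) ≥ Σ_{x,e} p(x,e) log q(x|e). -/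
open Finset

/-- The pointwise form of the Gibbs inequality. -/
lemma sub_le_mul_log_sub_mul_log {a b : ℝ} (ha : 0 < a) (hb : 0 < b) :
    a - b ≤ a * Real.log a - a * Real.log b := by
  have h := mul_le_mul_of_nonneg_left (Real.log_le_sub_one_of_pos (div_pos hb ha)) ha.le
  rw [Real.log_div hb.ne' ha.ne', mul_sub, mul_sub, mul_div_cancel₀ _ ha.ne'] at h
  linarith

/-- For every joint pmf `p` on `𝒳 × ℰ` and every variational
conditional distribution `q`, the mutual information dominates the expected
variational log-likelihood: `I(X;E) ≥ Σ_{x,e} p(x,e) log q(x|e)`. -/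
theorem mutualInfo_ge_expected_log_likelihood
    {𝒳 ℰ : Type*} [Fintype 𝒳] [Fintype ℰ]
    (p : 𝒳 → ℰ → ℝ) (hp : ∀ x e, 0 < p x e)
    (hpsum : ∑ x, ∑ e, p x e = 1)
    (q : 𝒳 → ℰ → ℝ) (hq : ∀ x e, 0 < q x e)
    (hqsum : ∀ e, ∑ x, q x e = 1) :
    ∑ x, ∑ e, p x e * Real.log ((p x e / ∑ x', p x' e) / ∑ e', p x e')
      ≥ ∑ x, ∑ e, p x e * Real.log (q x e) := by
  have hterm : ∀ x e, p x e - (∑ x', p x' e) * q x e ≤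
      p x e * Real.log ((p x e / ∑ x', p x' e) / ∑ e', p x e') - p x e * Real.log (q x e) := by
    intro x e
    have hE : 0 < ∑ x', p x' e := sum_pos (fun x' _ => hp x' e) ⟨x, mem_univ x⟩
    have hX : 0 < ∑ e', p x e' := sum_pos (fun e' _ => hp x e') ⟨e, mem_univ e⟩
    have hX1 : ∑ e', p x e' ≤ 1 := hpsum ▸
      single_le_sum (f := fun x' => ∑ e', p x' e')
        (fun x' _ => sum_nonneg fun e' _ => (hp x' e').le) (mem_univ x)
    have hlog := mul_nonpos_of_nonneg_of_nonpos (hp x e).le (Real.log_nonpos hX.le hX1)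
    have hgibbs := sub_le_mul_log_sub_mul_log (hp x e) (mul_pos hE (hq x e))
    rw [Real.log_mul hE.ne' (hq x e).ne'] at hgibbs
    rw [Real.log_div (div_pos (hp x e) hE).ne' hX.ne', Real.log_div (hp x e).ne' hE.ne']
    linarith
  have hmass : ∑ x, ∑ e, (∑ x', p x' e) * q x e = 1 := by
    rw [sum_comm]
    simp_rw [← mul_sum, hqsum, mul_one]
    rw [sum_comm, hpsum]
  have hsum := sum_le_sum fun x (_ : x ∈ univ) => sum_le_sum fun e (_ : e ∈ univ) => hterm x e
  simp only [sum_sub_distrib, hpsum, hmass] at hsum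
  linarith
end

section
/- Let Q : ℝᵐ × ℝⁿ → ℝᵐ × ℝⁿ be a differentiable bijection with differentiable inverse, and suppose the first component of Q depends only on the first argument: there exists φ : ℝᵐ → ℝᵐ such that (Q (c, z)).1 = φ c for all c ∈ ℝᵐ and z ∈ ℝⁿ. Then φ is differentiable, and for every c ∈ ℝᵐ the Fréchet derivative of φ at c is a bijective linear map from ℝᵐ to ℝᵐ (the top-left Jacobian block J₁₁ has nonzero determinant at every point). -/
/-- Let `Q : ℝᵐ × ℝⁿ → ℝᵐ × ℝⁿ` be a differentiable bijection with
differentiable inverse whose first component depends only on the first argument,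
say `(Q (c, z)).1 = φ c`. Then `φ` is differentiable and its Fréchet derivative at
every point is a bijective linear map (the top-left Jacobian block `J₁₁` is
invertible everywhere). -/
theorem firstComponent_fderiv_bijective
    (m n : ℕ)
    (Q R : (Fin m → ℝ) × (Fin n → ℝ) → (Fin m → ℝ) × (Fin n → ℝ))
    (hQ : Differentiable ℝ Q) (hR : Differentiable ℝ R)
    (hRQ : R ∘ Q = id) (hQR : Q ∘ R = id)
    (φ : (Fin m → ℝ) → (Fin m → ℝ))
    (hφ : ∀ (c : Fin m → ℝ) (z : Fin n → ℝ), (Q (c, z)).1 = φ c) :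
    Differentiable ℝ φ ∧ ∀ c, Function.Bijective (fderiv ℝ φ c) := by
  have hφ_diff : Differentiable ℝ φ := by
    have h : φ = fun c => (Q (c, 0)).1 := funext fun c => (hφ c 0).symm
    rw [h]
    fun_prop
  refine ⟨hφ_diff, fun c => ?_⟩
  have hsurj : Function.Surjective (fderiv ℝ φ c) := by
    intro w
    set p : (Fin m → ℝ) × (Fin n → ℝ) := (c, 0)
    have hRp : R (Q p) = p := congrFun hRQ p
    have hQ_fderiv : HasFDerivAt Q (fderiv ℝ Q p) (R (Q p)) := by
      rw [hRp]
      exact (hQ p).hasFDerivAt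
    have hcomp := hQ_fderiv.comp (Q p) (hR (Q p)).hasFDerivAt
    rw [hQR] at hcomp
    have hinv := hcomp.unique (hasFDerivAt_id (Q p))
    have hfst : HasFDerivAt (fun x => (Q x).1)
        ((ContinuousLinearMap.fst ℝ _ _).comp (fderiv ℝ Q p)) p :=
      hasFDerivAt_fst.comp p (hQ p).hasFDerivAt
    have hφ_fst : HasFDerivAt (fun x : (Fin m → ℝ) × (Fin n → ℝ) => φ x.1)
        ((fderiv ℝ φ c).comp (ContinuousLinearMap.fst ℝ _ _)) p :=
      HasFDerivAt.comp p (hφ_diff c).hasFDerivAt hasFDerivAt_fst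
    have heq : (fun x => (Q x).1) = fun x => φ x.1 := funext fun x => hφ x.1 x.2
    rw [heq] at hfst
    have hblock := hφ_fst.unique hfst
    refine ⟨(fderiv ℝ R (Q p) (w, 0)).1, ?_⟩
    have h₁ := DFunLike.congr_fun hblock (fderiv ℝ R (Q p) (w, 0))
    have h₂ := congrArg Prod.fst (DFunLike.congr_fun hinv (w, 0))
    exact h₁.trans h₂
  exact ⟨(LinearMap.injective_iff_surjective (f := (fderiv ℝ φ c).toLinearMap)).2 hsurj, hsurj⟩
end
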